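/- (Nazarov recursion and product formula, degenerate case.) Assume 2 is invertible in C. For each 0 ≤ m ≤ k−2 suppose z_m^{(ℓ)} (ℓ ∈ ℤ_{≥0}) are elements of the subalgebra of 𝓦_k generated by t_{s_1},…,t_{s_{m−1}}, e_1,…,e_{m−1}, y_1,…,y_m satisfying e_{m+1} y_{m+1}^ℓ e_{m+1} = z_m^{(ℓ)} e_{m+1}, and set z_m(u) = Σ_{ℓ≥0} z_m^{(ℓ)} u^{−ℓ}. Then in the ring of formal Laurent series in u⁻¹ over 𝓦_k: (i) for 1 ≤ i ≤ k−2, ( z_i(u) + εu − 1/2 ) e_{i+1} = ( z_{i−1}(u) + εu − 1/2 ) · ((u+y_i)² − 1)(u−y_i)² / ( ((u−y_i)² − 1)(u+y_i)² ) · e_{i+1}; and (ii) consequently, for 1 ≤ m ≤ k−2, ( z_m(u) + εu − 1/2 ) e_{m+1} = ( z_0(u) + εu − 1/2 ) ∏_{i=1}^{m} (u+y_i−1)(u+y_i+1)(u−y_i)² / ( (u+y_i)²(u−y_i+1)(u−y_i−1) ) · e_{m+1}, where z_0(u) = Σ_{ℓ≥0} z_0^{(ℓ)} u^{−ℓ}.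 -/

import Mathlib

/-- The simple transposition `sᵢ = (i, i+1)` (0-indexed) in the symmetric group on `Fin k`.
In the paper's 1-indexed notation, `sw k (i-1) _` is `s_i`. -/
def sw (k i : ℕ) (h : i + 1 < k) : Equiv.Perm (Fin k) :=
  Equiv.swap ⟨i, Nat.lt_of_succ_lt h⟩ ⟨i + 1, h⟩

/-- A `C`-algebra `A` together with elements satisfying the defining relations of the
degenerate affine BMW algebra `𝓦ₖ` with parameters `ε` and `z₀⁽ℓ⁾`.  Everything is
0-indexed: the paper's `s_i`, `y_i`, `e_i` (for `1 ≤ i`) are `sw k (i-1) _`, `y (i-1)`,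
`e (i-1) _` here.  The field `e_def` is the equation `t_{s_i} y_i = y_{i+1} t_{s_i} - (1 - e_i)`
defining `e_i`. -/
structure DegAffBMW (C : Type*) [CommRing C] (k : ℕ) (ε : C) (z₀ : ℕ → C)
    (A : Type*) [Ring A] [Algebra C A] where
  t : Equiv.Perm (Fin k) → A
  κ₀ : A
  κ₁ : A
  y : ℕ → A
  e : ∀ i : ℕ, i + 1 < k → A
  t_one : t 1 = 1
  t_mul : ∀ u v, t u * t v = t (u * v)
  y_comm : ∀ i j, i < k → j < k → y i * y j = y j * y i
  κ_comm : κ₀ * κ₁ = κ₁ * κ₀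
  κ₀_y : ∀ i, i < k → κ₀ * y i = y i * κ₀
  κ₁_y : ∀ i, i < k → κ₁ * y i = y i * κ₁
  κ₀_t : ∀ i (h : i + 1 < k), κ₀ * t (sw k i h) = t (sw k i h) * κ₀
  κ₁_braid : ∀ h : 1 < k,
      κ₁ * t (sw k 0 h) * κ₁ * t (sw k 0 h) = t (sw k 0 h) * κ₁ * t (sw k 0 h) * κ₁
  κ₁_t : ∀ j (h : j + 1 < k), j ≠ 0 → κ₁ * t (sw k j h) = t (sw k j h) * κ₁
  t_yy : ∀ i (h : i + 1 < k),
      t (sw k i h) * (y i + y (i + 1)) = (y i + y (i + 1)) * t (sw k i h)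
  y_t : ∀ i j (h : i + 1 < k), j < k → j ≠ i → j ≠ i + 1 →
      y j * t (sw k i h) = t (sw k i h) * y j
  γ_rel : ∀ i (h : i + 2 < k),
      t (sw k i (by omega)) * t (sw k (i + 1) h) *
          (y (i + 1) - t (sw k i (by omega)) * y i * t (sw k i (by omega))) *
          t (sw k (i + 1) h) * t (sw k i (by omega)) =
        y (i + 2) - t (sw k (i + 1) h) * y (i + 1) * t (sw k (i + 1) h)
  e_def : ∀ i (h : i + 1 < k),
      t (sw k i h) * y i = y (i + 1) * t (sw k i h) - (1 - e i h)
  e_t : ∀ i (h : i + 1 < k), e i h * t (sw k i h) = ε • e i h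
  t_e : ∀ i (h : i + 1 < k), t (sw k i h) * e i h = ε • e i h
  ete_up : ∀ i (h : i + 1 < k) (h' : i + 2 < k),
      e i h * t (sw k (i + 1) h') * e i h = ε • e i h
  ete_down : ∀ i (h : i + 1 < k) (h' : i - 1 + 1 < k), 1 ≤ i →
      e i h * t (sw k (i - 1) h') * e i h = ε • e i h
  eye : ∀ (h : 1 < k) (ℓ : ℕ), e 0 h * y 0 ^ ℓ * e 0 h = z₀ ℓ • e 0 h
  e_yy : ∀ i (h : i + 1 < k), e i h * (y i + y (i + 1)) = 0
  yy_e : ∀ i (h : i + 1 < k), (y i + y (i + 1)) * e i h = 0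

noncomputable section

/-- `1/(u - a) := Σ_{ℓ≥1} a^{ℓ-1} u^{-ℓ}`, a formal Laurent series in `u⁻¹`
(an element of `LaurentSeries A = HahnSeries ℤ A` whose variable is `u⁻¹`). -/
def invU {A : Type*} [Ring A] (a : A) : LaurentSeries A :=
  HahnSeries.ofPowerSeries ℤ A (PowerSeries.mk fun n => if n = 0 then 0 else a ^ (n - 1))

/-- `1/(2u - a) := Σ_{ℓ≥1} a^{ℓ-1} (2u)^{-ℓ}` (needs `2` invertible in `C`). -/
def inv2U (C : Type*) [CommRing C] [Invertible (2 : C)]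
    {A : Type*} [Ring A] [Algebra C A] (a : A) : LaurentSeries A :=
  HahnSeries.ofPowerSeries ℤ A
    (PowerSeries.mk fun n => if n = 0 then 0 else ((⅟2 : C) ^ n) • a ^ (n - 1))

/-- The variable `u` itself (the inverse of the Laurent series variable `u⁻¹`). -/
def Uvar (A : Type*) [Ring A] : LaurentSeries A := HahnSeries.single (-1 : ℤ) 1

/-- A constant Laurent series. -/
def cst {A : Type*} [Ring A] (a : A) : LaurentSeries A := HahnSeries.C a

end

noncomputable section

/-- The rational factor
`(u+y-1)(u+y+1)(u-y)² / ((u+y)²(u-y+1)(u-y-1)) = ((u+y)²-1)(u-y)² / (((u-y)²-1)(u+y)²)`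
as a formal Laurent series in `u⁻¹`, where `1/((u-y)²-1) = (1/(u-y-1))(1/(u-y+1))` and
`1/(u+y) = 1/(u-(-y))`. -/
def nazFactor {A : Type*} [Ring A] (a : A) : LaurentSeries A :=
  (Uvar A + cst a - 1) * (Uvar A + cst a + 1) * (Uvar A - cst a) ^ 2 *
    (invU (a + 1) * invU (a - 1)) * (invU (-a) * invU (-a))

end

theorem commute_inverse {R : Type*} [Ring R] {x p P : R} (h : Commute x p) (h1 : p * P = 1)
    (h2 : P * p = 1) : Commute x P :=
  (show Commute x ((⟨p, P, h1, h2⟩ : Rˣ) : R) from h).units_inv_right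

theorem contraction_identity {R : Type*} [Ring R] {s e f a b u c A A' B Z : R}
    (hu : ∀ x, u * x = x * u) (hc : ∀ x, c * x = x * c)
    (hA : (u - a) * A = 1) (hA₂ : A * (u - a) = 1)
    (hA' : (u + a) * A' = 1) (hA'₂ : A' * (u + a) = 1)
    (hB : (u - b) * B = 1) (hB₂ : B * (u - b) = 1)
    (hss : s * s = 1) (hes : e * s = c * e)
    (hfef : f * e * f = f) (hfsf : f * s * f = c * f)
    (hsa : s * a = b * s - (1 - e)) (has : a * s = s * b - (1 - e))
    (heab : e * (a + b) = 0) (habe : (a + b) * e = 0)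
    (hab : Commute a b) (hfa : Commute f a)
    (heAe : e * A * e = Z * e) (hfZ : Commute f Z) (haZ : Commute a Z)
    (hfsAsf : f * (s * A * s) * f = Z * f) :
    (1 - A * A) * (f * B * f) =
      (1 - A' * A') * (Z * f) + (c * (A * A - A' * A') - A * A' * (A - A')) * f := by
  have cinv : ∀ x, Commute x a → Commute x A := fun x hx =>
    commute_inverse (Commute.sub_right (hu x).symm hx) hA hA₂
  have cinv' : ∀ x, Commute x a → Commute x A' := fun x hx =>
    commute_inverse (Commute.add_right (hu x).symm hx) hA' hA'₂
  have hfA := cinv f hfa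
  have hfA' := cinv' f hfa
  have hAA' : Commute A A' := cinv' A (cinv a (Commute.refl a)).symm
  have hbA := cinv b hab.symm
  have hbA' := cinv' b hab.symm
  have hAB : Commute A B := commute_inverse (Commute.sub_right (hu A).symm hbA.symm) hB hB₂
  have hA'B : Commute A' B := commute_inverse (Commute.sub_right (hu A').symm hbA'.symm) hB hB₂
  have hZA := cinv Z haZ.symm
  have hZA' := cinv' Z haZ.symm
  have heB : e * B = e * A' := by
    have h : e * (u + a) = e * (u - b) := by
      have : e * (u + a) = e * (u - b) + e * (a + b) := by noncomm_ring
      rw [this, heab, add_zero]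
    calc e * B = e * ((u + a) * A') * B := by rw [hA', mul_one]
      _ = e * (u + a) * (A' * B) := by noncomm_ring
      _ = e * (u - b) * (B * A') := by rw [h, hA'B.eq]
      _ = e * ((u - b) * B) * A' := by noncomm_ring
      _ = e * A' := by rw [hB, mul_one]
  have hBe : B * e = A' * e := by
    have h : (u + a) * e = (u - b) * e := by
      have : (u + a) * e = (u - b) * e + (a + b) * e := by noncomm_ring
      rw [this, habe, add_zero]
    calc B * e = B * (A' * (u + a)) * e := by rw [hA'₂, mul_one]
      _ = (B * A') * ((u + a) * e) := by noncomm_ring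
      _ = (A' * B) * ((u - b) * e) := by rw [h, hA'B.eq]
      _ = A' * (B * (u - b)) * e := by noncomm_ring
      _ = A' * e := by rw [hB₂, mul_one]
  have hAs : A * s = s * B - A * B + A * e * A' := by
    have h : s * (u - b) = (u - a) * s - (1 - e) := by
      rw [mul_sub, sub_mul, has, ← hu s]; noncomm_ring
    have h2 : A * (s * (u - b)) * B = A * ((u - a) * s - (1 - e)) * B := by rw [h]
    have h3 : A * (s * (u - b)) * B = A * s * ((u - b) * B) := by noncomm_ring
    have h4 : A * ((u - a) * s - (1 - e)) * B =
        (A * (u - a)) * s * B - A * B + A * (e * B) := by noncomm_ring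
    rw [h3, h4, hB, hA₂, heB] at h2
    simpa [mul_assoc] using h2
  have hsA : s * A = B * s - B * A + A' * e * A := by
    have h : (u - b) * s = s * (u - a) - (1 - e) := by
      rw [mul_sub, sub_mul, hsa, ← hu s]; noncomm_ring
    have h2 : B * ((u - b) * s) * A = B * (s * (u - a) - (1 - e)) * A := by rw [h]
    have h3 : B * ((u - b) * s) * A = (B * (u - b)) * s * A := by noncomm_ring
    have h4 : B * (s * (u - a) - (1 - e)) * A =
        B * s * ((u - a) * A) - B * A + (B * e) * A := by noncomm_ring
    rw [h3, h4, hA, hB₂, hBe] at h2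
    simpa [mul_assoc] using h2
  have hfsAf : f * (s * A) * f = c * (A * f) := by
    calc f * (s * A) * f = f * s * (A * f) := by noncomm_ring
      _ = f * s * f * A := by rw [← hfA.eq]; noncomm_ring
      _ = c * (A * f) := by rw [hfsf, mul_assoc, hfA.eq]
  have hfBsf : f * (B * s) * f = c * (A * f) + A * (f * B * f) - A * A' * f := by
    have h : B * s = s * A + B * A - A' * e * A := by rw [hsA]; noncomm_ring
    have h1 : f * (B * A) * f = A * (f * B * f) := by
      rw [← hAB.eq, ← mul_assoc f, hfA.eq]; noncomm_ring
    have h2 : f * (A' * e * A) * f = A * A' * f := by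
      calc f * (A' * e * A) * f = (f * A') * e * (A * f) := by noncomm_ring
        _ = A' * (f * e * f) * A := by rw [hfA'.eq, ← hfA.eq]; noncomm_ring
        _ = A * A' * f := by rw [hfef, mul_assoc, hfA.eq, ← mul_assoc, hAA'.eq]
    calc f * (B * s) * f = f * (s * A) * f + f * (B * A) * f - f * (A' * e * A) * f := by
          rw [h]; noncomm_ring
      _ = _ := by rw [hfsAf, h1, h2]
  have hfeAsf : f * (e * (A * s)) * f = c * (A' * f) - A * A' * f + A' * (Z * f) := by
    have h1 : f * (e * A') * f = A' * f := by
      calc f * (e * A') * f = f * e * (A' * f) := by noncomm_ring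
        _ = f * e * f * A' := by rw [← hfA'.eq]; noncomm_ring
        _ = A' * f := by rw [hfef, hfA'.eq]
    have h2 : f * (e * (A * B)) * f = A * A' * f := by
      calc f * (e * (A * B)) * f = f * (e * B) * (A * f) := by rw [hAB.eq]; noncomm_ring
        _ = f * (e * A') * f * A := by rw [heB, ← hfA.eq]; noncomm_ring
        _ = A * A' * f := by rw [h1, mul_assoc, hfA.eq, ← mul_assoc, hAA'.eq]
    have h3 : f * (e * (A * e * A')) * f = A' * (Z * f) := by
      calc f * (e * (A * e * A')) * f = f * (e * A * e) * (A' * f) := by noncomm_ring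
        _ = (f * Z) * e * f * A' := by rw [heAe, ← hfA'.eq]; noncomm_ring
        _ = Z * (f * e * f) * A' := by rw [hfZ.eq]; noncomm_ring
        _ = A' * (Z * f) := by rw [hfef, mul_assoc, hfA'.eq, ← mul_assoc, hZA'.eq, mul_assoc]
    have h4 : f * (e * (s * B)) * f = c * (A' * f) := by
      calc f * (e * (s * B)) * f = f * (e * s) * B * f := by noncomm_ring
        _ = f * c * (e * B) * f := by rw [hes]; noncomm_ring
        _ = c * (f * (e * A') * f) := by rw [← hc f, heB]; noncomm_ring
        _ = _ := by rw [h1]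
    calc f * (e * (A * s)) * f =
          f * (e * (s * B)) * f - f * (e * (A * B)) * f + f * (e * (A * e * A')) * f := by
          rw [hAs]; noncomm_ring
      _ = _ := by rw [h4, h2, h3]
  have hmain : f * (s * A * s) * f =
      f * B * f - A * (f * (B * s) * f) + A' * (f * (e * (A * s)) * f) := by
    have h1 : f * (B * A * s) * f = A * (f * (B * s) * f) := by
      rw [← hAB.eq, ← mul_assoc A, ← mul_assoc A f, ← hfA.eq]; noncomm_ring
    have h2 : f * (A' * e * A * s) * f = A' * (f * (e * (A * s)) * f) := by
      rw [← mul_assoc A', ← mul_assoc A' f, ← hfA'.eq]; noncomm_ring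
    calc f * (s * A * s) * f =
          f * (B * (s * s)) * f - f * (B * A * s) * f + f * (A' * e * A * s) * f := by
          rw [hsA]; noncomm_ring
      _ = _ := by rw [hss, mul_one, h1, h2]
  rw [hfsAsf, hfBsf, hfeAsf] at hmain
  have h1 : A * (c * (A * f)) = c * (A * A * f) := by rw [← mul_assoc A c, ← hc A]; noncomm_ring
  have h2 : A' * (c * (A' * f)) = c * (A' * A' * f) := by
    rw [← mul_assoc A' c, ← hc A']; noncomm_ring
  have h3 : A' * (A * A' * f) = A * A' * A' * f := by
    rw [mul_assoc, ← mul_assoc A' A, ← hAA'.eq]; noncomm_ring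
  have h4 : A * A * (f * B * f) = f * B * f + A' * A' * (Z * f) - Z * f
      - c * (A * A * f) + c * (A' * A' * f) + A * A * A' * f - A * A' * A' * f := by
    rw [← h1, ← h2, ← h3]
    refine (sub_eq_zero.1 (Eq.trans ?_ (sub_eq_zero.2 hmain.symm))).symm
    noncomm_ring
  have h5 : A * A' * A = A * A * A' := by rw [mul_assoc, ← hAA'.eq, mul_assoc]
  rw [sub_mul, one_mul, h4, mul_sub (A * A'), h5]
  noncomm_ring

theorem exists_commutative_subring {R : Type*} [Ring R] (a : R) :
    ∃ (K : Subring R), a ∈ K ∧ (∀ x ∈ K, ∀ y ∈ K, x * y = y * x) ∧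
      (∀ x, (∀ y, x * y = y * x) → x ∈ K) ∧
      ∀ p ∈ K, ∀ P, p * P = 1 → P * p = 1 → P ∈ K := by
  refine ⟨Subring.centralizer (Subring.centralizer {a} : Set R), ?_, ?_, ?_, ?_⟩
  · exact Set.subset_centralizer_centralizer (Set.mem_singleton a)
  · exact Set.centralizer_centralizer_comm_of_comm (by simp)
  · intro x hx y _
    exact (hx y).symm
  · intro p hp P h1 h2 x hx
    exact commute_inverse (hp x hx) h1 h2

theorem rational_identities {K : Type*} [CommRing K] {a u h A A' P Q : K} (c : K)
    (h2 : h + h = 1) (hA : (u - a) * A = 1) (hA' : (u + a) * A' = 1)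
    (hP : (u - (a + 1)) * P = 1) (hQ : (u - (a - 1)) * Q = 1) :
    u * (u - a) ^ 2 * P * Q * (1 - A * A) = u ∧
    u * (u - a) ^ 2 * P * Q * (1 - A' * A') =
      (u + a - 1) * (u + a + 1) * (u - a) ^ 2 * (P * Q) * (A' * A') * u ∧
    u * (u - a) ^ 2 * P * Q * (c * (A * A - A' * A') - A * A' * (A - A')) =
      (u + a - 1) * (u + a + 1) * (u - a) ^ 2 * (P * Q) * (A' * A') * (c * u - h)
        - (c * u - h) := by
  have k1 : (u - a) ^ 2 * P * Q * (1 - A * A) = 1 := by grind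
  have k2 : (u + a - 1) * (u + a + 1) * (A' * A') = 1 - A' * A' := by grind
  have k3 : u * A * A' = h * (A + A') := by
    linear_combination h * (A' * hA + A * hA') - u * A * A' * h2
  refine ⟨by linear_combination u * k1, by linear_combination (-u * (u - a) ^ 2 * P * Q) * k2, ?_⟩
  linear_combination (-((u - a) ^ 2 * P * Q) * (A - A')) * k3
    - ((u - a) ^ 2 * P * Q) * (c * u - h) * k2 - (c * u - h) * k1

theorem recursion_of_contraction {R : Type*} [Ring R] {f a u c h A A' P Q F G : R}
    (hu : ∀ x, u * x = x * u) (hc : ∀ x, c * x = x * c)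
    (hh : ∀ x, h * x = x * h) (h2 : h + h = 1)
    (hA : (u - a) * A = 1) (hA₂ : A * (u - a) = 1)
    (hA' : (u + a) * A' = 1) (hA'₂ : A' * (u + a) = 1)
    (hP : (u - (a + 1)) * P = 1) (hP₂ : P * (u - (a + 1)) = 1)
    (hQ : (u - (a - 1)) * Q = 1) (hQ₂ : Q * (u - (a - 1)) = 1)
    (hFG : (1 - A * A) * F =
      (1 - A' * A') * G + (c * (A * A - A' * A') - A * A' * (A - A')) * f) :
    u * F + (c * u - h) * f =
      (u + a - 1) * (u + a + 1) * (u - a) ^ 2 * (P * Q) * (A' * A') * (u * G + (c * u - h) * f) := by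
  obtain ⟨K, ha, hcomm, hcen, hinv⟩ := exists_commutative_subring a
  let _ : CommRing K := { (inferInstance : Ring K) with
    mul_comm := fun x y => Subtype.ext (hcomm x x.2 y y.2) }
  have hu' := hcen u hu
  have hAK := hinv _ (K.sub_mem hu' ha) A hA hA₂
  have hA'K := hinv _ (K.add_mem hu' ha) A' hA' hA'₂
  have hPK := hinv _ (K.sub_mem hu' (K.add_mem ha K.one_mem)) P hP hP₂
  have hQK := hinv _ (K.sub_mem hu' (K.sub_mem ha K.one_mem)) Q hQ hQ₂
  lift c to K using hcen c hc
  lift h to K using hcen h hh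
  lift u to K using hu'
  lift a to K using ha
  lift A to K using hAK
  lift A' to K using hA'K
  lift P to K using hPK
  lift Q to K using hQK
  norm_cast at h2 hA hA' hP hQ
  obtain ⟨k1, k2, k3⟩ := rational_identities c h2 hA hA' hP hQ
  have c1 := congrArg (Subring.subtype K) k1
  have c2 := congrArg (Subring.subtype K) k2
  have c3 := congrArg (Subring.subtype K) k3
  simp only [map_mul, map_sub, map_add, map_pow, map_one, Subring.subtype_apply] at c1 c2 c3
  have hmul := congrArg (((u : R) * (u - a) ^ 2 * P * Q) * ·) hFG
  rw [mul_add] at hmul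
  rw [← mul_assoc _ _ F, c1, ← mul_assoc _ _ G, c2, ← mul_assoc _ _ f, c3] at hmul
  rw [hmul]
  noncomm_ring

theorem conjugate_sandwich {R : Type*} [Ring R] {s r e f A Z : R} (hrr : r * r = 1)
    (hss : s * s = 1) (hf : f = s * r * e * r * s) (hrA : Commute r A) (hsZ : Commute s Z)
    (hrZ : Commute r Z) (heAe : e * A * e = Z * e) : f * (s * A * s) * f = Z * f := by
  calc f * (s * A * s) * f
      = s * r * e * r * (s * s) * A * (s * s) * r * e * r * s := by rw [hf]; noncomm_ring
    _ = s * r * e * (r * A) * r * e * r * s := by rw [hss]; noncomm_ring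
    _ = s * r * e * A * (r * r) * e * r * s := by rw [hrA.eq]; noncomm_ring
    _ = s * r * (e * A * e) * r * s := by rw [hrr]; noncomm_ring
    _ = s * (r * Z) * e * r * s := by rw [heAe]; noncomm_ring
    _ = (s * Z) * r * e * r * s := by rw [hrZ.eq]; noncomm_ring
    _ = Z * f := by rw [hsZ.eq, hf]; noncomm_ring

namespace DegAffBMW

variable {C : Type*} [CommRing C] {k : ℕ} {ε : C} {z₀ : ℕ → C} {A : Type*} [Ring A] [Algebra C A]
  (B : DegAffBMW C k ε z₀ A)

theorem t_sq (i : ℕ) (h : i + 1 < k) : B.t (sw k i h) * B.t (sw k i h) = 1 := by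
  rw [B.t_mul, ← B.t_one]
  congr 1
  exact Equiv.swap_mul_self _ _

theorem t_braid (i : ℕ) (h : i + 2 < k) :
    B.t (sw k i (by omega)) * B.t (sw k (i + 1) h) * B.t (sw k i (by omega)) =
      B.t (sw k (i + 1) h) * B.t (sw k i (by omega)) * B.t (sw k (i + 1) h) := by
  simp only [B.t_mul]
  congr 1
  unfold sw
  rw [Equiv.swap_mul_swap_mul_swap (by simp) (by simp; omega),
    Equiv.swap_comm (⟨i, by omega⟩ : Fin k) ⟨i + 1, _⟩,
    Equiv.swap_comm (⟨i + 1, by omega⟩ : Fin k) ⟨i + 1 + 1, _⟩,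
    Equiv.swap_mul_swap_mul_swap (by simp) (by simp; omega), Equiv.swap_comm]

theorem t_comm {i j : ℕ} (hi : i + 1 < k) (hj : j + 1 < k) (hij : i + 2 ≤ j) :
    Commute (B.t (sw k i hi)) (B.t (sw k j hj)) := by
  show _ * _ = _ * _
  rw [B.t_mul, B.t_mul]
  congr 1
  apply Equiv.Perm.Disjoint.commute
  unfold sw
  refine Equiv.Perm.disjoint_swap_swap ?_
  simp
  omega

theorem e_eq (i : ℕ) (h : i + 1 < k) :
    B.e i h = B.t (sw k i h) * B.y i - B.y (i + 1) * B.t (sw k i h) + 1 := by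
  rw [B.e_def]; noncomm_ring

theorem y_mul_t (i : ℕ) (h : i + 1 < k) :
    B.y i * B.t (sw k i h) = B.t (sw k i h) * B.y (i + 1) - (1 - B.e i h) := by
  have h1 := B.t_yy i h
  have h2 := B.e_def i h
  rw [mul_add, add_mul, h2] at h1
  rw [← sub_eq_zero] at h1 ⊢
  rw [← neg_eq_zero, ← h1]
  noncomm_ring

theorem commute_e {x : A} (i : ℕ) (h : i + 1 < k) (ht : Commute x (B.t (sw k i h)))
    (hy : Commute x (B.y i)) (hy' : Commute x (B.y (i + 1))) : Commute x (B.e i h) := by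
  rw [B.e_eq]
  exact ((ht.mul_right hy).sub_right (hy'.mul_right ht)).add_right (Commute.one_right x)

theorem y_commute_e {i j : ℕ} (h : i + 1 < k) (hj : j < k) (h1 : j ≠ i) (h2 : j ≠ i + 1) :
    Commute (B.y j) (B.e i h) :=
  B.commute_e i h (B.y_t i j h hj h1 h2) (B.y_comm _ _ hj (by omega)) (B.y_comm _ _ hj h)

theorem commute_of_mem {m : ℕ} {x z : A}
    (hz : z ∈ Algebra.adjoin C
      ({x : A | ∃ j, ∃ hj : j + 1 < k, j + 2 ≤ m ∧ (x = B.t (sw k j hj) ∨ x = B.e j hj)} ∪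
        {x : A | ∃ j, j < m ∧ x = B.y j}))
    (ht : ∀ j (hj : j + 1 < k), j + 2 ≤ m → Commute x (B.t (sw k j hj)))
    (hy : ∀ j, j < m → Commute x (B.y j)) : Commute x z := by
  have hle : Algebra.adjoin C
      ({x : A | ∃ j, ∃ hj : j + 1 < k, j + 2 ≤ m ∧ (x = B.t (sw k j hj) ∨ x = B.e j hj)} ∪
        {x : A | ∃ j, j < m ∧ x = B.y j}) ≤ Subalgebra.centralizer C {x} := by
    refine Algebra.adjoin_le ?_
    rintro w (⟨j, hj, hjm, rfl | rfl⟩ | ⟨j, hj, rfl⟩) _ rfl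
    · exact ht j hj hjm
    · exact B.commute_e j hj (ht j hj hjm) (hy j (by omega)) (hy (j + 1) (by omega))
    · exact hy j hj
  exact hle hz x rfl

theorem t_commute_of_mem {m n : ℕ} {z : A} (hn : n + 1 < k) (hmn : m ≤ n)
    (hz : z ∈ Algebra.adjoin C
      ({x : A | ∃ j, ∃ hj : j + 1 < k, j + 2 ≤ m ∧ (x = B.t (sw k j hj) ∨ x = B.e j hj)} ∪
        {x : A | ∃ j, j < m ∧ x = B.y j})) : Commute (B.t (sw k n hn)) z :=
  B.commute_of_mem hz (fun _ hj hjm => (B.t_comm hj hn (by omega)).symm)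
    fun j hj => (B.y_t n j hn (by omega) (by omega) (by omega)).symm

theorem y_commute_of_mem {m n : ℕ} {z : A} (hn : n < k) (hmn : m ≤ n)
    (hz : z ∈ Algebra.adjoin C
      ({x : A | ∃ j, ∃ hj : j + 1 < k, j + 2 ≤ m ∧ (x = B.t (sw k j hj) ∨ x = B.e j hj)} ∪
        {x : A | ∃ j, j < m ∧ x = B.y j})) : Commute (B.y n) z :=
  B.commute_of_mem hz (fun _ hj _ => B.y_t _ n hj hn (by omega) (by omega))
    fun _ _ => B.y_comm _ _ hn (by omega)

theorem e_commute_of_mem {m n : ℕ} {z : A} (hn : n + 1 < k) (hmn : m ≤ n)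
    (hz : z ∈ Algebra.adjoin C
      ({x : A | ∃ j, ∃ hj : j + 1 < k, j + 2 ≤ m ∧ (x = B.t (sw k j hj) ∨ x = B.e j hj)} ∪
        {x : A | ∃ j, j < m ∧ x = B.y j})) : Commute (B.e n hn) z :=
  (B.commute_e n hn (B.t_commute_of_mem hn hmn hz).symm
    (B.y_commute_of_mem (by omega) hmn hz).symm
    (B.y_commute_of_mem hn (by omega) hz).symm).symm

theorem e_succ (hε : ε * ε = 1) (i : ℕ) (h : i + 2 < k) :
    B.e (i + 1) h = B.t (sw k i (by omega)) * B.t (sw k (i + 1) h) * B.e i (by omega) *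
      B.t (sw k (i + 1) h) * B.t (sw k i (by omega)) := by
  have hγ := B.γ_rel i h
  have h1 : B.y (i + 1) - B.t (sw k i (by omega)) * B.y i * B.t (sw k i (by omega)) =
      B.t (sw k i (by omega)) - ε • B.e i (by omega) := by
    rw [B.e_def, sub_mul, mul_assoc, B.t_sq, sub_mul, B.e_t]; noncomm_ring
  have h2 : B.y (i + 2) - B.t (sw k (i + 1) h) * B.y (i + 1) * B.t (sw k (i + 1) h) =
      B.t (sw k (i + 1) h) - ε • B.e (i + 1) h := by
    rw [B.e_def, sub_mul, mul_assoc, B.t_sq, sub_mul, B.e_t]; noncomm_ring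
  rw [h1, h2] at hγ
  have hbr := B.t_braid i h
  have hs := B.t_sq i (by omega)
  have hr := B.t_sq (i + 1) h
  generalize B.t (sw k i (by omega)) = s at *
  generalize B.t (sw k (i + 1) h) = r at *
  have h3 : s * r * s * r * s = r := by
    calc s * r * s * r * s = (s * r * s) * r * s := rfl
      _ = r * s * (r * r) * s := by rw [hbr]; noncomm_ring
      _ = r * (s * s) := by rw [hr]; noncomm_ring
      _ = r := by rw [hs, mul_one]
  rw [mul_sub, sub_mul, sub_mul, h3, sub_right_inj] at hγ
  simp only [mul_smul_comm, smul_mul_assoc] at hγ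
  have := congrArg (ε • ·) hγ
  simpa [smul_smul, hε] using this.symm

theorem e_mul_e_mul_e (hε : ε * ε = 1) (i : ℕ) (h : i + 2 < k) :
    B.e (i + 1) h * B.e i (by omega) * B.e (i + 1) h = B.e (i + 1) h := by
  have hf := B.e_succ hε i h
  have hfs := B.ete_down (i + 1) h (by omega) (by omega)
  simp only [Nat.add_sub_cancel] at hfs
  have hs := B.t_sq i (by omega)
  have hr := B.t_sq (i + 1) h
  have hfr := B.e_t (i + 1) h
  have hrf := B.t_e (i + 1) h
  generalize B.t (sw k i (by omega)) = s at *
  generalize B.t (sw k (i + 1) h) = r at *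
  generalize B.e (i + 1) h = f at *
  have he : B.e i (by omega) = r * s * f * s * r := by
    calc B.e i (by omega) = (r * (s * s) * r) * B.e i (by omega) * (r * (s * s) * r) := by
          rw [hs, mul_one, hr, one_mul, mul_one]
      _ = r * s * (s * r * B.e i (by omega) * r * s) * s * r := by noncomm_ring
      _ = _ := by rw [← hf]
  calc f * B.e i (by omega) * f = (f * r) * s * f * s * (r * f) := by rw [he]; noncomm_ring
    _ = (f * s * f) * s * f := by
      rw [hfr, hrf]; simp [smul_smul, hε]
    _ = f := by rw [hfs]; simp [hfs, smul_smul, hε]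

end DegAffBMW

theorem Uvar_mul_comm {A : Type*} [Ring A] (x : LaurentSeries A) :
    Uvar A * x = x * Uvar A := by
  ext n
  simp [Uvar, HahnSeries.coeff_single_mul, HahnSeries.coeff_mul_single]

theorem Uvar_mul_ofPowerSeries_X {A : Type*} [Ring A] :
    Uvar A * HahnSeries.ofPowerSeries ℤ A PowerSeries.X = 1 := by
  simp [Uvar, HahnSeries.ofPowerSeries_X]

theorem cst_eq_ofPowerSeries {A : Type*} [Ring A] (a : A) :
    cst a = HahnSeries.ofPowerSeries ℤ A (PowerSeries.C a) :=
  (HahnSeries.ofPowerSeries_C a).symm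

theorem invU_eq {A : Type*} [Ring A] (a : A) :
    invU a = HahnSeries.ofPowerSeries ℤ A (PowerSeries.X * PowerSeries.mk fun n => a ^ n) := by
  unfold invU
  congr 1
  ext n
  cases n <;> simp [PowerSeries.coeff_succ_X_mul]

theorem Uvar_mul_invU {A : Type*} [Ring A] (a : A) :
    Uvar A * invU a = HahnSeries.ofPowerSeries ℤ A (PowerSeries.mk fun n => a ^ n) := by
  rw [invU_eq, map_mul, ← mul_assoc, Uvar_mul_ofPowerSeries_X, one_mul]

theorem sub_cst_mul_invU {A : Type*} [Ring A] (a : A) : (Uvar A - cst a) * invU a = 1 := by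
  rw [sub_mul, Uvar_mul_invU, invU_eq, cst_eq_ofPowerSeries, ← map_mul, ← map_sub,
    ← map_one (HahnSeries.ofPowerSeries ℤ A)]
  congr 1
  ext n
  cases n <;> simp [PowerSeries.coeff_succ_X_mul, pow_succ', PowerSeries.coeff_one]

theorem invU_mul_sub_cst {A : Type*} [Ring A] (a : A) : invU a * (Uvar A - cst a) = 1 := by
  rw [mul_sub, ← Uvar_mul_comm, Uvar_mul_invU, invU_eq, cst_eq_ofPowerSeries, ← map_mul,
    ← map_sub, ← map_one (HahnSeries.ofPowerSeries ℤ A)]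
  congr 1
  ext n
  cases n <;> simp [PowerSeries.coeff_succ_X_mul, mul_assoc, pow_succ, PowerSeries.coeff_one]

theorem add_cst_mul_invU {A : Type*} [Ring A] (a : A) : (Uvar A + cst a) * invU (-a) = 1 := by
  simpa [cst] using sub_cst_mul_invU (-a)

theorem invU_mul_add_cst {A : Type*} [Ring A] (a : A) : invU (-a) * (Uvar A + cst a) = 1 := by
  simpa [cst] using invU_mul_sub_cst (-a)

theorem commute_cst_ofPowerSeries {A : Type*} [Ring A] {x : A} {g : ℕ → A}
    (h : ∀ n, Commute x (g n)) :
    Commute (cst x) (HahnSeries.ofPowerSeries ℤ A (PowerSeries.mk g)) := by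
  show _ * _ = _ * _
  rw [cst_eq_ofPowerSeries, ← map_mul, ← map_mul]
  congr 1
  ext n
  simpa using (h n).eq

theorem cst_mul_invU_mul_cst {A : Type*} [Ring A] {e a : A} {g : ℕ → A}
    (h : ∀ n, e * a ^ n * e = g n * e) :
    Uvar A * (cst e * invU a * cst e) =
      HahnSeries.ofPowerSeries ℤ A (PowerSeries.mk g) * cst e := by
  rw [← mul_assoc, ← mul_assoc, Uvar_mul_comm, mul_assoc (cst e), Uvar_mul_invU,
    cst_eq_ofPowerSeries, ← map_mul, ← map_mul, ← map_mul]
  congr 1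
  ext n
  simpa using h n

theorem commute_cst {A : Type*} [Ring A] {x y : A} (h : Commute x y) :
    Commute (cst x) (cst y) := by
  show _ * _ = _ * _
  unfold cst
  rw [← map_mul, ← map_mul, h.eq]

theorem commute_nazFactor {A : Type*} [Ring A] {x : LaurentSeries A} {a : A}
    (h : Commute x (cst a)) : Commute x (nazFactor a) := by
  have hU : Commute x (Uvar A) := (Uvar_mul_comm x).symm
  have h1 := Commute.one_right x
  have hcst : ∀ b, Commute x (cst b) → Commute x (invU b) := fun b hb =>
    commute_inverse (hU.sub_right hb) (sub_cst_mul_invU b) (invU_mul_sub_cst b)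
  have hp : Commute x (cst (a + 1)) := by simpa [cst] using h.add_right h1
  have hm : Commute x (cst (a - 1)) := by simpa [cst] using h.sub_right h1
  have hn : Commute x (cst (-a)) := by simpa [cst] using h.neg_right
  unfold nazFactor
  exact ((((((hU.add_right h).sub_right h1).mul_right ((hU.add_right h).add_right h1)).mul_right
    ((hU.sub_right h).pow_right 2)).mul_right ((hcst _ hp).mul_right (hcst _ hm))).mul_right
    ((hcst _ hn).mul_right (hcst _ hn)))

theorem commute_normalized_series {C A : Type*} [CommRing C] [Ring A] [Algebra C A] {x : A}
    {g : ℕ → A} (c h : C) (hx : ∀ n, Commute x (g n)) :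
    Commute (cst x) (HahnSeries.ofPowerSeries ℤ A (PowerSeries.mk g) + c • Uvar A -
      h • (1 : LaurentSeries A)) :=
  ((commute_cst_ofPowerSeries hx).add_right
    (Commute.smul_right (Uvar_mul_comm (cst x)).symm c)).sub_right
    (Commute.smul_right (Commute.one_right _) h)

theorem DegAffBMW.recursion_step {C : Type*} [CommRing C] [Invertible (2 : C)] {k : ℕ} {ε : C}
    {z₀ : ℕ → C} {A : Type*} [Ring A] [Algebra C A] (B : DegAffBMW C k ε z₀ A) (hε : ε * ε = 1)
    {j : ℕ} (h : j + 2 < k) {g g' : ℕ → A}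
    (hs : ∀ ℓ, Commute (B.t (sw k j (by omega))) (g ℓ))
    (hr : ∀ ℓ, Commute (B.t (sw k (j + 1) h)) (g ℓ))
    (ha : ∀ ℓ, Commute (B.y j) (g ℓ)) (hf : ∀ ℓ, Commute (B.e (j + 1) h) (g ℓ))
    (hg : ∀ ℓ, B.e j (by omega) * B.y j ^ ℓ * B.e j (by omega) = g ℓ * B.e j (by omega))
    (hg' : ∀ ℓ, B.e (j + 1) h * B.y (j + 1) ^ ℓ * B.e (j + 1) h = g' ℓ * B.e (j + 1) h) :
    (HahnSeries.ofPowerSeries ℤ A (PowerSeries.mk g') + ε • Uvar A -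
          (⅟2 : C) • (1 : LaurentSeries A)) * cst (B.e (j + 1) h) =
      (HahnSeries.ofPowerSeries ℤ A (PowerSeries.mk g) + ε • Uvar A -
          (⅟2 : C) • (1 : LaurentSeries A)) * nazFactor (B.y j) * cst (B.e (j + 1) h) := by
  have hN := (commute_nazFactor (commute_normalized_series ε (⅟2 : C) ha).symm).eq
  have hUU := Uvar_mul_comm (A := A)
  have hUV := Uvar_mul_ofPowerSeries_X (A := A)
  have hfeq := B.e_succ hε j h
  have hfef := B.e_mul_e_mul_e hε j h
  have hfsf := B.ete_down (j + 1) h (by omega) (by omega)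
  simp only [Nat.add_sub_cancel] at hfsf
  have hhalf : algebraMap C (LaurentSeries A) ⅟2 + algebraMap C (LaurentSeries A) ⅟2 = 1 := by
    rw [← map_add, ← two_mul, mul_invOf_self, map_one]
  set Z := HahnSeries.ofPowerSeries ℤ A PowerSeries.X *
    HahnSeries.ofPowerSeries ℤ A (PowerSeries.mk g) with hZ
  have hVc : ∀ x : A, Commute (cst x) (HahnSeries.ofPowerSeries ℤ A PowerSeries.X) := fun x => by
    show _ * _ = _ * _
    rw [cst_eq_ofPowerSeries, ← map_mul, ← map_mul, (PowerSeries.commute_X _).eq]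
  have hUZ : Uvar A * Z = HahnSeries.ofPowerSeries ℤ A (PowerSeries.mk g) := by
    rw [hZ, ← mul_assoc, hUV, one_mul]
  have hcZ : ∀ x : A, (∀ ℓ, Commute x (g ℓ)) → Commute (cst x) Z := fun x hx =>
    (hVc x).mul_right (commute_cst_ofPowerSeries hx)
  have heAe : cst (B.e j (by omega)) * invU (B.y j) * cst (B.e j (by omega)) =
      Z * cst (B.e j (by omega)) := by
    have h1 := cst_mul_invU_mul_cst hg
    rw [hZ, mul_assoc (HahnSeries.ofPowerSeries ℤ A PowerSeries.X), ← h1, ← mul_assoc _ (Uvar A),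
      ← hUU, hUV, one_mul]
  have hra : Commute (B.t (sw k (j + 1) h)) (B.y j) :=
    (B.y_t (j + 1) j h (by omega) (by omega) (by omega)).symm
  have hsandwich := conjugate_sandwich (s := cst (B.t (sw k j (by omega))))
    (r := cst (B.t (sw k (j + 1) h))) (e := cst (B.e j (by omega)))
    (f := cst (B.e (j + 1) h)) (A := invU (B.y j)) (Z := Z)
    (by simpa [cst] using congrArg cst (B.t_sq (j + 1) h))
    (by simpa [cst] using congrArg cst (B.t_sq j (by omega)))
    (by simpa [cst] using congrArg cst hfeq)
    (commute_inverse (Commute.sub_right (hUU _).symm (commute_cst hra))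
      (sub_cst_mul_invU _) (invU_mul_sub_cst _))
    (hcZ _ hs) (hcZ _ hr) heAe
  have hcon := contraction_identity (u := Uvar A) (c := algebraMap C (LaurentSeries A) ε)
    hUU (Algebra.commutes ε)
    (sub_cst_mul_invU (B.y j)) (invU_mul_sub_cst (B.y j))
    (add_cst_mul_invU (B.y j)) (invU_mul_add_cst (B.y j))
    (sub_cst_mul_invU (B.y (j + 1))) (invU_mul_sub_cst (B.y (j + 1)))
    (s := cst (B.t (sw k j (by omega)))) (e := cst (B.e j (by omega)))
    (f := cst (B.e (j + 1) h)) (Z := Z)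
    (by simpa [cst] using congrArg cst (B.t_sq j (by omega)))
    (by simpa [cst, Algebra.smul_def, HahnSeries.algebraMap_apply] using
      congrArg cst (B.e_t j (by omega)))
    (by simpa [cst] using congrArg cst hfef)
    (by simpa [cst, Algebra.smul_def, HahnSeries.algebraMap_apply] using congrArg cst hfsf)
    (by simpa [cst] using congrArg cst (B.e_def j (by omega)))
    (by simpa [cst] using congrArg cst (B.y_mul_t j (by omega)))
    (by unfold cst; rw [← map_add, ← map_mul, B.e_yy, map_zero])
    (by unfold cst; rw [← map_add, ← map_mul, B.yy_e, map_zero])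
    (commute_cst (B.y_comm j (j + 1) (by omega) (by omega)))
    (commute_cst (B.y_commute_e h (by omega) (by omega) (by omega)).symm)
    heAe (hcZ _ hf) (hcZ _ ha) hsandwich
  have hrec := recursion_of_contraction (P := invU (B.y j + 1)) (Q := invU (B.y j - 1))
    hUU (Algebra.commutes ε) (Algebra.commutes (⅟2 : C)) hhalf
    (sub_cst_mul_invU (B.y j)) (invU_mul_sub_cst (B.y j))
    (add_cst_mul_invU (B.y j)) (invU_mul_add_cst (B.y j))
    (by simpa [cst] using sub_cst_mul_invU (B.y j + 1))
    (by simpa [cst] using invU_mul_sub_cst (B.y j + 1))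
    (by simpa [cst] using sub_cst_mul_invU (B.y j - 1))
    (by simpa [cst] using invU_mul_sub_cst (B.y j - 1)) hcon
  rw [cst_mul_invU_mul_cst hg', ← mul_assoc (Uvar A), hUZ, ← add_mul, ← add_mul,
    ← Algebra.smul_def] at hrec
  rw [hN, mul_assoc (nazFactor _), Algebra.smul_def (⅟2 : C), mul_one, add_sub_assoc,
    add_sub_assoc]
  exact hrec

/-- Nazarov recursion (3.7) and product formula (3.8), degenerate case.
All indices are 0-indexed: the paper's `e_{m+1}`, `y_{m+1}`, `z_m` correspond to
`e m _`, `y m`, `zc m` here; the subalgebra `𝓦_m` is generated by the `t (sw k j _), e j _`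
with `j + 2 ≤ m` and the `y j` with `j < m`. -/
theorem degenerate_affine_BMW_Nazarov_recursion
    (C : Type*) [CommRing C] [Invertible (2 : C)] (k : ℕ) (ε : C) (z₀ : ℕ → C)
    (A : Type*) [Ring A] [Algebra C A]
    (hk : 3 ≤ k) (hε : ε = 1 ∨ ε = -1)
    (B : DegAffBMW C k ε z₀ A)
    (zc : ℕ → ℕ → A)
    (hmem : ∀ m ℓ, m + 1 < k → zc m ℓ ∈ Algebra.adjoin C
      ({x : A | ∃ j, ∃ hj : j + 1 < k, j + 2 ≤ m ∧ (x = B.t (sw k j hj) ∨ x = B.e j hj)} ∪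
        {x : A | ∃ j, j < m ∧ x = B.y j}))
    (hz : ∀ m ℓ (hm : m + 1 < k), B.e m hm * B.y m ^ ℓ * B.e m hm = zc m ℓ * B.e m hm) :
    -- (i) the recursion `(z_i(u)+εu-1/2) e_{i+1} = (z_{i-1}(u)+εu-1/2)·(factor)·e_{i+1}`
    (∀ j (h : j + 2 < k),
      (HahnSeries.ofPowerSeries ℤ A (PowerSeries.mk fun ℓ => zc (j + 1) ℓ) + ε • Uvar A -
            (⅟2 : C) • (1 : LaurentSeries A)) * cst (B.e (j + 1) h) =
        (HahnSeries.ofPowerSeries ℤ A (PowerSeries.mk fun ℓ => zc j ℓ) + ε • Uvar A -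
            (⅟2 : C) • (1 : LaurentSeries A)) * nazFactor (B.y j) * cst (B.e (j + 1) h)) ∧
    -- (ii) the product formula
    (∀ m (hm : m + 1 < k), 1 ≤ m →
      (HahnSeries.ofPowerSeries ℤ A (PowerSeries.mk fun ℓ => zc m ℓ) + ε • Uvar A -
            (⅟2 : C) • (1 : LaurentSeries A)) * cst (B.e m hm) =
        (HahnSeries.ofPowerSeries ℤ A (PowerSeries.mk fun ℓ => zc 0 ℓ) + ε • Uvar A -
            (⅟2 : C) • (1 : LaurentSeries A)) *
          ((List.range m).map fun j => nazFactor (B.y j)).prod * cst (B.e m hm)) := by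
  have hεε : ε * ε = 1 := by rcases hε with rfl | rfl <;> simp
  have hrec : ∀ j (h : j + 2 < k),
      (HahnSeries.ofPowerSeries ℤ A (PowerSeries.mk fun ℓ => zc (j + 1) ℓ) + ε • Uvar A -
            (⅟2 : C) • (1 : LaurentSeries A)) * cst (B.e (j + 1) h) =
        (HahnSeries.ofPowerSeries ℤ A (PowerSeries.mk fun ℓ => zc j ℓ) + ε • Uvar A -
            (⅟2 : C) • (1 : LaurentSeries A)) * nazFactor (B.y j) * cst (B.e (j + 1) h) :=
    fun j h => B.recursion_step hεε h
      (fun ℓ => B.t_commute_of_mem (by omega) le_rfl (hmem j ℓ (by omega)))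
      (fun ℓ => B.t_commute_of_mem h (by omega) (hmem j ℓ (by omega)))
      (fun ℓ => B.y_commute_of_mem (by omega) le_rfl (hmem j ℓ (by omega)))
      (fun ℓ => B.e_commute_of_mem h (by omega) (hmem j ℓ (by omega)))
      (fun ℓ => hz j ℓ (by omega)) (fun ℓ => hz (j + 1) ℓ h)
  refine ⟨hrec, fun m hm _ => ?_⟩
  induction m with
  | zero => simp
  | succ m ih =>
    have ih := ih (by omega)
    rcases Nat.eq_zero_or_pos m with rfl | hpos
    · simpa using hrec 0 hm
    replace ih := ih hpos
    rw [hrec m hm, List.range_succ, List.map_append, List.prod_append]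
    have hfef : cst (B.e (m + 1) hm) * cst (B.e m (by omega)) * cst (B.e (m + 1) hm) =
        cst (B.e (m + 1) hm) := by
      simpa [cst] using congrArg cst (B.e_mul_e_mul_e hεε m hm)
    have hfX : ∀ l, l ≤ m → Commute (cst (B.e (m + 1) hm))
        (HahnSeries.ofPowerSeries ℤ A (PowerSeries.mk fun ℓ => zc l ℓ) + ε • Uvar A -
            (⅟2 : C) • (1 : LaurentSeries A)) := fun l hl =>
      commute_normalized_series ε (⅟2 : C) fun ℓ =>
        B.e_commute_of_mem hm (by omega) (hmem l ℓ (by omega))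
    have hNX : ∀ l, l ≤ m → Commute (nazFactor (B.y m))
        (HahnSeries.ofPowerSeries ℤ A (PowerSeries.mk fun ℓ => zc l ℓ) + ε • Uvar A -
            (⅟2 : C) • (1 : LaurentSeries A)) := fun l hl =>
      (commute_nazFactor (commute_normalized_series ε (⅟2 : C) fun ℓ =>
        B.y_commute_of_mem (by omega) hl (hmem l ℓ (by omega))).symm).symm
    have hfD : Commute (cst (B.e (m + 1) hm))
        ((List.range m).map fun j => nazFactor (B.y j)).prod := by
      refine Commute.list_prod_right _ _ fun x hx => ?_
      obtain ⟨j, hj, rfl⟩ := List.mem_map.1 hx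
      rw [List.mem_range] at hj
      exact commute_nazFactor (commute_cst
        (B.y_commute_e hm (by omega) (by omega) (by omega)).symm)
    have hND : Commute (nazFactor (B.y m))
        ((List.range m).map fun j => nazFactor (B.y j)).prod := by
      refine Commute.list_prod_right _ _ fun x hx => ?_
      obtain ⟨j, hj, rfl⟩ := List.mem_map.1 hx
      rw [List.mem_range] at hj
      exact commute_nazFactor (commute_nazFactor (commute_cst
        (B.y_comm j m (by omega) (by omega)))).symm
    have hfX₀ := hfX 0 (by omega)
    have hNX₀ := hNX 0 (by omega)
    replace hfX := hfX m le_rfl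
    replace hNX := hNX m le_rfl
    simp only [List.map_cons, List.map_nil, List.prod_cons, List.prod_nil, mul_one]
    generalize cst (B.e (m + 1) hm) = f at *
    generalize cst (B.e m (by omega)) = e at *
    generalize nazFactor (B.y m) = N at *
    generalize ((List.range m).map fun j => nazFactor (B.y j)).prod = D at *
    generalize HahnSeries.ofPowerSeries ℤ A (PowerSeries.mk fun ℓ => zc m ℓ) + ε • Uvar A -
      (⅟2 : C) • (1 : LaurentSeries A) = X at *
    generalize HahnSeries.ofPowerSeries ℤ A (PowerSeries.mk fun ℓ => zc 0 ℓ) + ε • Uvar A -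
      (⅟2 : C) • (1 : LaurentSeries A) = X₀ at *
    calc X * N * f = N * (X * f) * e * f := by
          rw [← hNX.eq, mul_assoc N, mul_assoc N, mul_assoc N, mul_assoc X, mul_assoc X, hfef]
      _ = N * f * (X * e) * f := by rw [← hfX.eq]; noncomm_ring
      _ = N * (f * X₀) * D * e * f := by rw [ih]; noncomm_ring
      _ = N * X₀ * (f * D) * e * f := by rw [hfX₀.eq]; noncomm_ring
      _ = N * X₀ * D * (f * e * f) := by rw [hfD.eq]; noncomm_ring
      _ = X₀ * (N * D) * f := by rw [hfef, hNX₀.eq]; noncomm_ring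
      _ = X₀ * (D * N) * f := by rw [hND.eq]
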